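/- Let 0 < δ < 1, let J* ⊆ [N]×[N] be nonempty with |J*| = s, and let Θ* ∈ ℝ^{N×N} be supported exactly on J* with ‖Θ*‖²_Fro ≤ K²N. Let ρ be the normalized restriction of μ_{J*} to the Frobenius ball {Θ : ‖Θ − Θ*‖_Fro < δ}. Then ρ is absolutely continuous with respect to the L0-sparsity prior μ and KL(ρ‖μ) ≤ s·log(√(K²N+1)/δ) + s·log(eN²/s) + s·log(1/α) + log(1/(1−α)). -/

import Mathlib

open Finset Matrix MeasureTheory

/-- Euclidean norm of a vector in `ℝ^N`. -/
noncomputable def vnorm {N : ℕ} (v : Fin N → ℝ) : ℝ := Real.sqrt (∑ i, (v i) ^ 2)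

/-- Operator (spectral) norm of an `N × N` real matrix. -/
noncomputable def onorm {N : ℕ} (A : Matrix (Fin N) (Fin N) ℝ) : ℝ :=
  sSup {x : ℝ | ∃ v : Fin N → ℝ, vnorm v ≤ 1 ∧ x = vnorm (A.mulVec v)}

/-- Frobenius norm of an `N × N` real matrix. -/
noncomputable def fnorm {N : ℕ} (A : Matrix (Fin N) (Fin N) ℝ) : ℝ :=
  Real.sqrt (∑ i, ∑ j, (A i j) ^ 2)

instance matMS {N : ℕ} : MeasurableSpace (Matrix (Fin N) (Fin N) ℝ) :=
  MeasurableSpace.pi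

/-- The scaling map `Z(Θ) = K Θ / ‖Θ‖`. -/
noncomputable def Zmap {N : ℕ} (K : ℝ) (Θ : Matrix (Fin N) (Fin N) ℝ) :
    Matrix (Fin N) (Fin N) ℝ := (K / onorm Θ) • Θ

/-- Empirical risk `r_t(Θ) = (1/t) Σ_{s=1}^t ‖D_s − Θ p_s‖²`. -/
noncomputable def emprisk {N : ℕ} (t : ℕ) (D p : ℕ → Fin N → ℝ)
    (Θ : Matrix (Fin N) (Fin N) ℝ) : ℝ :=
  (1 / (t : ℝ)) * ∑ s ∈ Finset.Icc 1 t, vnorm (D s - Θ.mulVec (p s)) ^ 2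

/-- True (in-sample) risk `R_t(Θ) = (1/t) Σ_{s=1}^t ‖(Θ − Θ*) p_s‖²`. -/
noncomputable def Rrisk {N : ℕ} (t : ℕ) (p : ℕ → Fin N → ℝ)
    (Θstar Θ : Matrix (Fin N) (Fin N) ℝ) : ℝ :=
  (1 / (t : ℝ)) * ∑ s ∈ Finset.Icc 1 t, vnorm ((Θ - Θstar).mulVec (p s)) ^ 2

/-- The Gibbs (exponential-weights) posterior
`dρ/dμ(Θ) = exp(−λ·risk(Z(Θ))) / ∫ exp(−λ·risk(Z(Θ'))) dμ(Θ')`. -/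
noncomputable def gibbs {N : ℕ} (μ : Measure (Matrix (Fin N) (Fin N) ℝ)) (K lam : ℝ)
    (risk : Matrix (Fin N) (Fin N) ℝ → ℝ) : Measure (Matrix (Fin N) (Fin N) ℝ) :=
  μ.withDensity fun Θ =>
    ENNReal.ofReal (Real.exp (-lam * risk (Zmap K Θ)) /
      ∫ Θ', Real.exp (-lam * risk (Zmap K Θ')) ∂μ)

/-- The PAC-Bayesian estimator `Θ̂ = ∫ Z(Θ) dρ(Θ)`, computed entrywise. -/
noncomputable def pacEstimator {N : ℕ} (K : ℝ)
    (ρ : Measure (Matrix (Fin N) (Fin N) ℝ)) : Matrix (Fin N) (Fin N) ℝ :=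
  Matrix.of fun i j => ∫ Θ, Zmap K Θ i j ∂ρ

/-- Kullback–Leibler divergence `KL(ρ‖μ) = ∫ log(dρ/dμ) dρ` (real-valued version,
meaningful when `ρ ≪ μ`). -/
noncomputable def klDiv {α : Type*} [MeasurableSpace α] (ρ μ : Measure α) : ℝ :=
  ∫ x, Real.log ((ρ.rnDeriv μ x).toReal) ∂ρ

/-- Embed a vector of entries indexed by the support set `J` as an `N × N` matrix
that vanishes off `J`. -/
def matOfSupp {N : ℕ} (J : Finset (Fin N × Fin N)) (x : {e // e ∈ J} → ℝ) :
    Matrix (Fin N) (Fin N) ℝ :=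
  Matrix.of fun i j => if h : (i, j) ∈ J then x ⟨(i, j), h⟩ else 0

/-- The Frobenius ball `{x : ℝ^J | Σ_e x_e² ≤ K²N + 1}` in support coordinates. -/
def suppBall {N : ℕ} (K : ℝ) (J : Finset (Fin N × Fin N)) : Set ({e // e ∈ J} → ℝ) :=
  {x | ∑ e, (x e) ^ 2 ≤ K ^ 2 * N + 1}

/-- `μ_J`: the uniform probability measure on
`J_K = {Θ : ‖Θ‖²_Fro ≤ K²N + 1, supp Θ = J}`, realized as the normalized Lebesgue
measure on the Frobenius ball in the coordinates of the support `J`, pushed forward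
to matrices. -/
noncomputable def muJ {N : ℕ} (K : ℝ) (J : Finset (Fin N × Fin N)) :
    Measure (Matrix (Fin N) (Fin N) ℝ) :=
  Measure.map (matOfSupp J)
    ((volume (suppBall K J))⁻¹ • volume.restrict (suppBall K J))

/-- The `L₀` mixing probabilities `π_J = α^{|J|}/(Σ_{i=0}^{N²} α^i)·binom(N²,|J|)⁻¹`. -/
noncomputable def piL0 {N : ℕ} (α : ℝ) (J : Finset (Fin N × Fin N)) : ℝ :=
  α ^ J.card / (∑ i ∈ Finset.range (N ^ 2 + 1), α ^ i) *
    (((N ^ 2).choose J.card : ℝ))⁻¹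

/-- The `L₀`-sparsity prior `μ = Σ_{J ⊆ [N]×[N]} π_J μ_J`. -/
noncomputable def muL0 {N : ℕ} (K α : ℝ) : Measure (Matrix (Fin N) (Fin N) ℝ) :=
  ∑ J : Finset (Fin N × Fin N), ENNReal.ofReal (piL0 α J) • muJ K J

lemma measure_ball_le_two_mul_half {E : Type*} [NormedAddCommGroup E] [InnerProductSpace ℝ E]
    [MeasurableSpace E] [BorelSpace E] (μ : Measure E) [μ.IsNegInvariant] (θ : E) (r : ℝ) :
    μ (Metric.ball 0 r) ≤ 2 * μ {x ∈ Metric.ball (0 : E) r | inner ℝ θ x ≤ 0} := by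
  set A := {x ∈ Metric.ball (0 : E) r | inner ℝ θ x ≤ 0} with hA
  have hneg : μ (Neg.neg ⁻¹' A) = μ A := Measure.measure_preimage_neg μ A
  calc μ (Metric.ball 0 r) ≤ μ (A ∪ Neg.neg ⁻¹' A) := by
        refine measure_mono fun x hx => ?_
        rcases le_total (inner ℝ θ x) 0 with h | h
        · exact Or.inl ⟨hx, h⟩
        · refine Or.inr ⟨?_, ?_⟩
          · simpa using hx
          · simpa using h
    _ ≤ μ A + μ (Neg.neg ⁻¹' A) := measure_union_le _ _
    _ = 2 * μ A := by rw [hneg, two_mul]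

/-- At least half of a ball of radius at most `1` around `θ` lies in any centred ball of radius
at least `√(‖θ‖² + 1)`. -/
lemma measure_ball_le_two_mul_inter {E : Type*} [NormedAddCommGroup E] [InnerProductSpace ℝ E]
    [MeasurableSpace E] [BorelSpace E] [FiniteDimensional ℝ E] (μ : Measure E)
    [μ.IsAddHaarMeasure] {θ : E} {r R : ℝ} (hr : r ≤ 1) (hR : 0 ≤ R) (hθ : ‖θ‖ ^ 2 + 1 ≤ R ^ 2) :
    μ (Metric.ball 0 r) ≤ 2 * μ (Metric.ball θ r ∩ Metric.closedBall 0 R) := by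
  refine (measure_ball_le_two_mul_half μ θ r).trans ?_
  gcongr 2 * ?_
  rw [← measure_preimage_add μ θ (Metric.ball θ r ∩ Metric.closedBall 0 R)]
  refine measure_mono fun x ⟨hx, hθx⟩ => ?_
  rw [mem_ball_zero_iff] at hx
  refine ⟨by simpa using hx, ?_⟩
  rw [mem_closedBall_zero_iff]
  refine abs_le_of_sq_le_sq' ?_ hR |>.2
  rw [norm_add_sq_real]
  nlinarith [norm_nonneg x]

lemma measure_closedBall_le_mul_inter {E : Type*} [NormedAddCommGroup E] [InnerProductSpace ℝ E]
    [MeasurableSpace E] [BorelSpace E] [FiniteDimensional ℝ E] (μ : Measure E)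
    [μ.IsAddHaarMeasure] {θ : E} {r R : ℝ} (hr₀ : 0 < r) (hr : r ≤ 1) (hR : 0 < R)
    (hθ : ‖θ‖ ^ 2 + 1 ≤ R ^ 2) :
    μ (Metric.closedBall 0 R) ≤ ENNReal.ofReal (2 * (R / r) ^ Module.finrank ℝ E) *
      μ (Metric.ball θ r ∩ Metric.closedBall 0 R) := by
  have h := measure_ball_le_two_mul_inter μ hr hR.le hθ
  have hball : μ (Metric.closedBall 0 R) =
      ENNReal.ofReal ((R / r) ^ Module.finrank ℝ E) * μ (Metric.ball 0 r) := by
    rw [Measure.addHaar_closedBall μ _ hR.le, Measure.addHaar_ball_of_pos μ _ hr₀, ← mul_assoc,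
      ← ENNReal.ofReal_mul (by positivity), ← mul_pow, div_mul_cancel₀ _ hr₀.ne']
  rw [hball, mul_comm 2, ENNReal.ofReal_mul (by positivity), mul_assoc]
  gcongr
  simpa using h

lemma sum_sq_eq_sum_supp {N : ℕ} {J : Finset (Fin N × Fin N)} {A : Matrix (Fin N) (Fin N) ℝ}
    (hA : ∀ i j, (i, j) ∉ J → A i j = 0) :
    ∑ i, ∑ j, (A i j) ^ 2 = ∑ e : {e // e ∈ J}, (A e.1.1 e.1.2) ^ 2 := by
  rw [Finset.sum_coe_sort J (fun e => (A e.1 e.2) ^ 2), ← Fintype.sum_prod_type']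
  refine (Finset.sum_subset (Finset.subset_univ _) fun e _ he => ?_).symm
  rw [hA _ _ he]; norm_num

lemma measurable_matOfSupp {N : ℕ} (J : Finset (Fin N × Fin N)) : Measurable (matOfSupp J) := by
  refine measurable_pi_lambda _ fun i => measurable_pi_lambda _ fun j => ?_
  by_cases h : (i, j) ∈ J
  · simpa [matOfSupp, h] using measurable_pi_apply _
  · simp [matOfSupp, h]

lemma measurableSet_fnorm_ball {N : ℕ} (A : Matrix (Fin N) (Fin N) ℝ) (δ : ℝ) :
    MeasurableSet {Θ : Matrix (Fin N) (Fin N) ℝ | fnorm (Θ - A) < δ} := by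
  refine measurableSet_lt ?_ measurable_const
  refine (Finset.measurable_sum _ fun i _ => Finset.measurable_sum _ fun j _ => ?_).sqrt
  have : Measurable fun Θ : Matrix (Fin N) (Fin N) ℝ => Θ i j :=
    (measurable_pi_apply j).comp (measurable_pi_apply i)
  exact (this.sub_const _).pow_const 2

lemma suppBall_preimage {N : ℕ} (K : ℝ) (J : Finset (Fin N × Fin N)) :
    (WithLp.ofLp : EuclideanSpace ℝ {e // e ∈ J} → _) ⁻¹' suppBall K J =
      Metric.closedBall 0 (Real.sqrt (K ^ 2 * N + 1)) := by
  ext x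
  rw [mem_closedBall_zero_iff, EuclideanSpace.norm_eq, Real.sqrt_le_sqrt_iff (by positivity)]
  simp [suppBall]

lemma measurableSet_suppBall {N : ℕ} (K : ℝ) (J : Finset (Fin N × Fin N)) :
    MeasurableSet (suppBall K J) := by
  refine measurableSet_le ?_ measurable_const
  fun_prop

lemma volume_suppBall {N : ℕ} (K : ℝ) (J : Finset (Fin N × Fin N)) :
    volume (suppBall K J) = volume (Metric.closedBall
      (0 : EuclideanSpace ℝ {e // e ∈ J}) (Real.sqrt (K ^ 2 * N + 1))) := by
  rw [← suppBall_preimage, (PiLp.volume_preserving_ofLp _).measure_preimage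
    (measurableSet_suppBall K J).nullMeasurableSet]

/-- The Frobenius ball of radius `δ` around a point with `‖Θ‖² ≤ K²N` carries mass at least
`(δ / √(K²N + 1)) ^ |J| / 2` under `μ_J`. -/
lemma one_le_mul_muJ_ball {N : ℕ} (K δ : ℝ) (hδ : 0 < δ) (hδ₁ : δ ≤ 1)
    (J : Finset (Fin N × Fin N)) (Θ : Matrix (Fin N) (Fin N) ℝ)
    (hsupp : ∀ i j, (i, j) ∉ J → Θ i j = 0) (hfro : fnorm Θ ^ 2 ≤ K ^ 2 * N) :
    1 ≤ ENNReal.ofReal (2 * (Real.sqrt (K ^ 2 * N + 1) / δ) ^ J.card) *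
      muJ K J {A | fnorm (A - Θ) < δ} := by
  set R := Real.sqrt (K ^ 2 * N + 1) with hR
  have hRpos : 0 < R := Real.sqrt_pos.2 (by positivity)
  have hRsq : R ^ 2 = K ^ 2 * N + 1 := Real.sq_sqrt (by positivity)
  set θ : EuclideanSpace ℝ {e // e ∈ J} := WithLp.toLp 2 fun e => Θ e.1.1 e.1.2 with hθdef
  have hθ : ‖θ‖ ^ 2 + 1 ≤ R ^ 2 := by
    rw [fnorm, Real.sq_sqrt (by positivity), sum_sq_eq_sum_supp hsupp] at hfro
    rw [EuclideanSpace.norm_sq_eq, hRsq]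
    simpa [hθdef] using hfro
  have key := measure_closedBall_le_mul_inter volume hδ hδ₁ hRpos hθ
  rw [finrank_euclideanSpace, Fintype.card_coe] at key
  have hB := measurableSet_fnorm_ball Θ δ
  have hpre : (WithLp.ofLp : EuclideanSpace ℝ {e // e ∈ J} → _) ⁻¹'
      (matOfSupp J ⁻¹' {A | fnorm (A - Θ) < δ} ∩ suppBall K J) =
      Metric.ball θ δ ∩ Metric.closedBall 0 R := by
    rw [Set.preimage_inter, suppBall_preimage]
    congr 1
    ext x
    have h0 : ∀ i j, (i, j) ∉ J → (matOfSupp J x.ofLp - Θ) i j = 0 := fun i j hij => by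
      simp [matOfSupp, hij, hsupp i j hij]
    rw [mem_ball_iff_norm, EuclideanSpace.norm_eq]
    simp only [Set.mem_preimage, Set.mem_ofPred_eq, fnorm, sum_sq_eq_sum_supp h0]
    simp [matOfSupp, hθdef]
  have hV := volume_suppBall K J
  rw [← hR] at hV
  have hV0 : volume (suppBall K J) ≠ 0 := by
    rw [hV]; exact (Metric.measure_closedBall_pos _ _ hRpos).ne'
  have hVt : volume (suppBall K J) ≠ ⊤ := by
    rw [hV]; exact measure_closedBall_lt_top.ne
  have hmeas := (measurable_matOfSupp J) hB
  rw [muJ, Measure.map_apply (measurable_matOfSupp J) hB, Measure.smul_apply,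
    Measure.restrict_apply hmeas, ← (PiLp.volume_preserving_ofLp _).measure_preimage
    (hmeas.inter (measurableSet_suppBall K J)).nullMeasurableSet, hpre, smul_eq_mul,
    mul_left_comm, ← ENNReal.inv_mul_cancel hV0 hVt]
  gcongr
  rwa [hV]

lemma muJ_univ_le_one {N : ℕ} (K : ℝ) (J : Finset (Fin N × Fin N)) :
    muJ K J Set.univ ≤ 1 := by
  rw [muJ, Measure.map_apply (measurable_matOfSupp J) .univ]
  simp [ENNReal.inv_mul_le_one]

instance isFiniteMeasure_muL0 {N : ℕ} (K α : ℝ) : IsFiniteMeasure (muL0 (N := N) K α) := by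
  refine ⟨?_⟩
  simp only [muL0, Measure.finsetSum_apply, Measure.smul_apply, smul_eq_mul]
  exact ENNReal.sum_lt_top.2 fun J _ =>
    ENNReal.mul_lt_top ENNReal.ofReal_lt_top ((muJ_univ_le_one K J).trans_lt ENNReal.one_lt_top)

lemma klDiv_le_of_le_smul {X : Type*} [MeasurableSpace X] {ρ μ : Measure X}
    [IsProbabilityMeasure ρ] [IsFiniteMeasure μ] {L : ℝ} (hL : 0 ≤ L)
    (h : ρ ≤ ENNReal.ofReal (Real.exp L) • μ) : klDiv ρ μ ≤ L := by
  have hac : ρ ≪ μ := (Measure.absolutelyContinuous_of_le h).trans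
    Measure.smul_absolutelyContinuous
  have hle : ρ.rnDeriv μ ≤ᵐ[μ] fun _ => ENNReal.ofReal (Real.exp L) := by
    refine ae_le_of_forall_setLIntegral_le_of_sigmaFinite (Measure.measurable_rnDeriv _ _)
      fun s _ _ => ?_
    refine (Measure.setLIntegral_rnDeriv_le s).trans ?_
    simpa using h s
  have hlog : ∀ᵐ x ∂ρ, Real.log (ρ.rnDeriv μ x).toReal ≤ L := by
    filter_upwards [hac.ae_le hle] with x hx
    rcases (ENNReal.toReal_nonneg (a := ρ.rnDeriv μ x)).eq_or_lt with h0 | h0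
    · simpa [← h0] using hL
    · rw [Real.log_le_iff_le_exp h0]
      exact ENNReal.toReal_le_of_le_ofReal (Real.exp_pos L).le hx
  by_cases hi : Integrable (fun x => Real.log (ρ.rnDeriv μ x).toReal) ρ
  · calc klDiv ρ μ ≤ ∫ _, L ∂ρ := integral_mono_ae hi (integrable_const _) hlog
      _ = L := by simp
  · rwa [klDiv, integral_undef hi]

lemma two_mul_choose_le {n s : ℕ} (hs : 0 < s) :
    2 * (n.choose s : ℝ) ≤ (Real.exp 1 * n / s) ^ s := by
  have hs' : (0 : ℝ) < s := by exact_mod_cast hs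
  have hexp : 2 * ((s : ℝ) ^ s / s.factorial) ≤ Real.exp s := by
    refine le_trans ?_ (Real.sum_le_exp_of_nonneg hs'.le (s + 1))
    obtain ⟨k, rfl⟩ := Nat.exists_eq_add_one_of_ne_zero hs.ne'
    have hk : ((k + 1 : ℕ) : ℝ) ^ k / k.factorial =
        ((k + 1 : ℕ) : ℝ) ^ (k + 1) / (k + 1).factorial := by
      rw [Nat.factorial_succ, pow_succ]
      push_cast
      field_simp
    rw [Finset.sum_range_succ, Finset.sum_range_succ, hk]
    have : 0 ≤ ∑ i ∈ Finset.range k, ((k + 1 : ℕ) : ℝ) ^ i / i.factorial :=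
      Finset.sum_nonneg fun i _ => by positivity
    linarith
  calc 2 * (n.choose s : ℝ) ≤ 2 * ((n : ℝ) ^ s / s.factorial) := by
        gcongr; exact Nat.choose_le_pow_div s n
    _ = 2 * ((s : ℝ) ^ s / s.factorial) * (n / s) ^ s := by
        rw [div_pow]; field_simp
    _ ≤ Real.exp s * (n / s) ^ s := by gcongr
    _ = (Real.exp 1 * n / s) ^ s := by
        rw [mul_div_assoc, mul_pow, ← Real.exp_nat_mul, mul_one]

lemma piL0_pos {N : ℕ} {α : ℝ} (hα : 0 < α) (J : Finset (Fin N × Fin N)) : 0 < piL0 α J := by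
  have hc : J.card ≤ N ^ 2 := by simpa [sq] using J.card_le_univ
  have := Nat.choose_pos hc
  have : 0 < ∑ i ∈ Finset.range (N ^ 2 + 1), α ^ i :=
    Finset.sum_pos (fun i _ => by positivity) (by simp)
  unfold piL0
  positivity

lemma two_mul_inv_piL0_le {N : ℕ} {α : ℝ} (hα : α ∈ Set.Ioo (0 : ℝ) 1)
    {J : Finset (Fin N × Fin N)} (hJ : J.Nonempty) :
    2 * (piL0 α J)⁻¹ ≤
      (Real.exp 1 * N ^ 2 / J.card) ^ J.card * (1 / α) ^ J.card * (1 / (1 - α)) := by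
  obtain ⟨h0, h1⟩ := hα
  have hgeom : ∑ i ∈ Finset.range (N ^ 2 + 1), α ^ i ≤ 1 / (1 - α) := by
    rw [one_div, ← tsum_geometric_of_lt_one h0.le h1]
    exact (summable_geometric_of_lt_one h0.le h1).sum_le_tsum _ fun i _ => by positivity
  have hchoose := two_mul_choose_le (n := N ^ 2) hJ.card_pos
  push_cast at hchoose
  calc 2 * (piL0 α J)⁻¹ = 2 * ((N ^ 2).choose J.card : ℝ) * (1 / α) ^ J.card *
        ∑ i ∈ Finset.range (N ^ 2 + 1), α ^ i := by
        rw [piL0, mul_inv, inv_div, inv_inv, one_div, inv_pow]; ring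
    _ ≤ _ := by
        have : 0 ≤ 1 / α := by positivity
        gcongr

/-- KL bound for the normalized restriction of `μ_{J*}` to a Frobenius
ball around an `L₀`-sparse `Θ*`, against the `L₀`-sparsity prior. -/
theorem kl_bound_L0_prior
    {N : ℕ} (hN : 0 < N) (K α δ : ℝ) (hK : 0 < K)
    (hα : α ∈ Set.Ioo (0 : ℝ) 1) (hδ : δ ∈ Set.Ioo (0 : ℝ) 1)
    (Jstar : Finset (Fin N × Fin N)) (hJstar : Jstar.Nonempty)
    (s : ℕ) (hs : s = Jstar.card)
    (Θstar : Matrix (Fin N) (Fin N) ℝ)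
    (hsupp : ∀ i j, Θstar i j ≠ 0 ↔ (i, j) ∈ Jstar)
    (hfro : fnorm Θstar ^ 2 ≤ K ^ 2 * N)
    (ρ : Measure (Matrix (Fin N) (Fin N) ℝ))
    (hρ : ρ = (muJ K Jstar {Θ | fnorm (Θ - Θstar) < δ})⁻¹ •
        (muJ K Jstar).restrict {Θ | fnorm (Θ - Θstar) < δ}) :
    ρ ≪ muL0 K α ∧
      klDiv ρ (muL0 K α) ≤
        s * Real.log (Real.sqrt (K ^ 2 * N + 1) / δ) +
        s * Real.log (Real.exp 1 * N ^ 2 / s) +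
        s * Real.log (1 / α) + Real.log (1 / (1 - α)) := by
  set B := {Θ : Matrix (Fin N) (Fin N) ℝ | fnorm (Θ - Θstar) < δ}
  set L := s * Real.log (Real.sqrt (K ^ 2 * N + 1) / δ) +
        s * Real.log (Real.exp 1 * N ^ 2 / s) +
        s * Real.log (1 / α) + Real.log (1 / (1 - α)) with hL
  have hspos : 0 < s := hs ▸ hJstar.card_pos
  have hspos' : (0 : ℝ) < s := by exact_mod_cast hspos
  have hsN : (s : ℝ) ≤ N ^ 2 := by
    have : Jstar.card ≤ N ^ 2 := by simpa [sq] using Jstar.card_le_univ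
    rw [hs]; exact_mod_cast this
  obtain ⟨hα0, hα1⟩ := hα
  obtain ⟨hδ0, hδ1⟩ := hδ
  have hNpos : (0 : ℝ) < N := by exact_mod_cast hN
  have hone : 0 < 1 - α := by linarith
  have hR : 1 ≤ Real.sqrt (K ^ 2 * N + 1) := Real.one_le_sqrt.2 (by nlinarith [sq_nonneg K])
  have hL0 : 0 ≤ L := by
    have h1 : 0 ≤ Real.log (Real.sqrt (K ^ 2 * N + 1) / δ) :=
      Real.log_nonneg ((one_le_div hδ0).2 (by linarith))
    have h2 : 0 ≤ Real.log (Real.exp 1 * N ^ 2 / s) :=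
      Real.log_nonneg ((one_le_div hspos').2 (by nlinarith [Real.add_one_le_exp (1 : ℝ)]))
    have h3 : 0 ≤ Real.log (1 / α) := Real.log_nonneg ((one_le_div hα0).2 hα1.le)
    have h4 : 0 ≤ Real.log (1 / (1 - α)) := Real.log_nonneg ((one_le_div hone).2 (by linarith))
    positivity
  have hexpL : Real.exp L = (Real.sqrt (K ^ 2 * N + 1) / δ) ^ s *
      ((Real.exp 1 * N ^ 2 / s) ^ s * (1 / α) ^ s * (1 / (1 - α))) := by
    rw [hL, Real.exp_add, Real.exp_add, Real.exp_add, Real.exp_nat_mul, Real.exp_nat_mul,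
      Real.exp_nat_mul, Real.exp_log (by positivity), Real.exp_log (by positivity),
      Real.exp_log (by positivity), Real.exp_log (by positivity)]
    ring
  have hmass := one_le_mul_muJ_ball K δ hδ0 hδ1.le Jstar Θstar
    (fun i j hij => by simpa using (hsupp i j).not.2 hij) hfro
  have hB0 : muJ K Jstar B ≠ 0 := fun h => by simp [B, h] at hmass
  have hBt : muJ K Jstar B ≠ ⊤ := ((measure_mono (Set.subset_univ _)).trans
    (muJ_univ_le_one K Jstar)).trans_lt ENNReal.one_lt_top |>.ne
  have hprob : IsProbabilityMeasure ρ :=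
    ⟨by simp [hρ, ENNReal.inv_mul_cancel hB0 hBt]⟩
  have hπ := piL0_pos hα0 Jstar
  have hmix : ENNReal.ofReal (piL0 α Jstar) • muJ K Jstar ≤ muL0 K α :=
    Finset.single_le_sum (f := fun J => ENNReal.ofReal (piL0 α J) • muJ K J)
      (fun _ _ => Measure.zero_le _) (Finset.mem_univ Jstar)
  have hinv : (muJ K Jstar B)⁻¹ ≤
      ENNReal.ofReal (Real.exp L) * ENNReal.ofReal (piL0 α Jstar) := by
    calc (muJ K Jstar B)⁻¹ ≤
          ENNReal.ofReal (2 * (Real.sqrt (K ^ 2 * N + 1) / δ) ^ Jstar.card) := by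
          rwa [ENNReal.inv_le_iff_le_mul (fun _ => hB0) (fun h => absurd h hBt), mul_comm]
      _ ≤ _ := by
          rw [← ENNReal.ofReal_mul (Real.exp_pos L).le]
          refine ENNReal.ofReal_le_ofReal ?_
          have h := two_mul_inv_piL0_le ⟨hα0, hα1⟩ hJstar
          rw [← div_eq_mul_inv, div_le_iff₀ hπ] at h
          rw [hexpL, mul_comm 2, mul_assoc, hs]
          gcongr
  have hle : ρ ≤ ENNReal.ofReal (Real.exp L) • muL0 K α := by
    refine Measure.le_iff'.2 fun t => ?_
    rw [hρ, Measure.smul_apply, Measure.smul_apply, smul_eq_mul, smul_eq_mul]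
    calc (muJ K Jstar B)⁻¹ * (muJ K Jstar).restrict B t
        ≤ ENNReal.ofReal (Real.exp L) * ENNReal.ofReal (piL0 α Jstar) * muJ K Jstar t := by
          gcongr; exact Measure.restrict_le_self
      _ ≤ _ := by
          rw [mul_assoc]; gcongr; exact hmix t
  exact ⟨(Measure.absolutelyContinuous_of_le hle).trans Measure.smul_absolutelyContinuous,
    klDiv_le_of_le_smul hL0 hle⟩
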